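/- Symplectic invariance of the intersection number: let L1, L2 be continuous paths of Lagrangian subspaces of a real symplectic vector space (E, ω) on [a,b], and let A : [a,b] → Sp(E) be a continuous path of symplectic automorphisms. Then t ↦ A(t)L1(t) and t ↦ A(t)L2(t) are continuous paths of Lagrangian subspaces and [A(t)L1(t) : A(t)L2(t)] = [L1 : L2]. -/

import Mathlib

open LinearMap (BilinForm)

variable {E : Type*} [NormedAddCommGroup E] [NormedSpace ℝ E]

/-- A subspace is Lagrangian iff it equals its symplectic orthogonal. -/
def IsLagrangian (ω : BilinForm ℝ E) (L : Submodule ℝ E) : Prop :=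
  LinearMap.BilinForm.orthogonal ω L = L

/-- Maximal dimension of a subspace on which the function `Q` is positive away from `0`. -/
noncomputable def posIndex {V : Type*} [AddCommGroup V] [Module ℝ V] (Q : V → ℝ) : ℕ :=
  sSup {d : ℕ | ∃ W : Submodule ℝ V, Module.finrank ℝ W = d ∧ ∀ x ∈ W, x ≠ 0 → 0 < Q x}

/-- The quadratic form `Q(L1,L2,L3)` of a triplet of subspaces,
`Q(x1,x2,x3) = ω(x1,x2) + ω(x2,x3) + ω(x3,x1)`. -/
def tripleQ (ω : BilinForm ℝ E) (L1 L2 L3 : Submodule ℝ E) (v : L1 × L2 × L3) : ℝ :=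
  ω v.1 v.2.1 + ω v.2.1 v.2.2 + ω v.2.2 v.1

/-- The signature `s(L1,L2,L3)` of a triplet of subspaces: the signature (number of positive
squares minus number of negative squares in a diagonalization) of `Q(L1,L2,L3)`. -/
noncomputable def tripleSig (ω : BilinForm ℝ E) (L1 L2 L3 : Submodule ℝ E) : ℤ :=
  (posIndex (tripleQ ω L1 L2 L3) : ℤ) - (posIndex (fun v => - tripleQ ω L1 L2 L3 v) : ℤ)

/-- A continuous path of Lagrangian subspaces of `(E, ω)` on the interval `[a,b]`:  a family
`(L t)` of Lagrangian subspaces such that every `t0 ∈ [a,b]` has a neighbourhood `U` in `[a,b]`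
on which there is a continuous family of idempotent linear maps of `E` with range `L t`. -/
structure IsLagrangianPath (ω : BilinForm ℝ E) (a b : ℝ) (L : ℝ → Submodule ℝ E) : Prop where
  lag : ∀ t ∈ Set.Icc a b, IsLagrangian ω (L t)
  locTriv : ∀ t0 ∈ Set.Icc a b, ∃ U ∈ nhdsWithin t0 (Set.Icc a b), U ⊆ Set.Icc a b ∧
    ∃ P : ℝ → E →L[ℝ] E, ContinuousOn P U ∧
      ∀ t ∈ U, (P t).comp (P t) = P t ∧ LinearMap.range (P t : E →ₗ[ℝ] E) = L t

/-- A jointly continuous two-parameter family `(L s t)`, `s ∈ [0,1]`, `t ∈ [a,b]`, of Lagrangian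
subspaces (a homotopy of paths of Lagrangian subspaces). -/
structure IsLagrangianHomotopy (ω : BilinForm ℝ E) (a b : ℝ)
    (L : ℝ → ℝ → Submodule ℝ E) : Prop where
  lag : ∀ s ∈ Set.Icc (0:ℝ) 1, ∀ t ∈ Set.Icc a b, IsLagrangian ω (L s t)
  locTriv : ∀ p ∈ Set.Icc (0:ℝ) 1 ×ˢ Set.Icc a b,
    ∃ U ∈ nhdsWithin p (Set.Icc (0:ℝ) 1 ×ˢ Set.Icc a b),
      U ⊆ Set.Icc (0:ℝ) 1 ×ˢ Set.Icc a b ∧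
      ∃ P : ℝ × ℝ → E →L[ℝ] E, ContinuousOn P U ∧
        ∀ q ∈ U, (P q).comp (P q) = P q ∧ LinearMap.range (P q : E →ₗ[ℝ] E) = L q.1 q.2

/-- Admissible data for a pair of paths of Lagrangian subspaces on `[a,b]`:  a partition
`a = t_0 ≤ t_1 ≤ … ≤ t_k = b` together with Lagrangian subspaces `M_1, …, M_k` such that
`M_ν ∩ L_i(t) = 0` for all `t ∈ [t_{ν-1}, t_ν]`, `i = 1,2`.  (Here `M (ν+1)` plays the role
of `M_{ν+1}` for `0 ≤ ν < k`.) -/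
structure AdmissibleData (ω : BilinForm ℝ E) (a b : ℝ) (L1 L2 : ℝ → Submodule ℝ E) where
  k : ℕ
  kpos : 0 < k
  t : ℕ → ℝ
  M : ℕ → Submodule ℝ E
  ht0 : t 0 = a
  htk : t k = b
  hmono : ∀ ν < k, t ν ≤ t (ν + 1)
  hlag : ∀ ν < k, IsLagrangian ω (M (ν + 1))
  htrans1 : ∀ ν < k, ∀ s ∈ Set.Icc (t ν) (t (ν + 1)), M (ν + 1) ⊓ L1 s = ⊥
  htrans2 : ∀ ν < k, ∀ s ∈ Set.Icc (t ν) (t (ν + 1)), M (ν + 1) ⊓ L2 s = ⊥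

/-- The expression `(1/2) Σ_ν ( s(L1(t_{ν-1}), L2(t_{ν-1}), M_ν) − s(L1(t_ν), L2(t_ν), M_ν) )`
computed from admissible data; by well-definedness this is the intersection number `[L1 : L2]`. -/
noncomputable def dataSum {ω : BilinForm ℝ E} {a b : ℝ} {L1 L2 : ℝ → Submodule ℝ E}
    (D : AdmissibleData ω a b L1 L2) : ℝ :=
  (1 / 2 : ℝ) * ∑ ν ∈ Finset.range D.k,
    ((tripleSig ω (L1 (D.t ν)) (L2 (D.t ν)) (D.M (ν + 1)) : ℝ)
      - (tripleSig ω (L1 (D.t (ν + 1))) (L2 (D.t (ν + 1))) (D.M (ν + 1)) : ℝ))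

/-- A continuous path of symplectic automorphisms of `(E, ω)` on `[a,b]`. -/
structure IsSymplecticPath (ω : BilinForm ℝ E) (a b : ℝ) (A : ℝ → E →L[ℝ] E) : Prop where
  bij : ∀ t ∈ Set.Icc a b, Function.Bijective (A t)
  symp : ∀ t ∈ Set.Icc a b, ∀ x y, ω (A t x) (A t y) = ω x y
  cont : ContinuousOn A (Set.Icc a b)

/-- The symplectic form of `E × E⁻`: `((x1,x2),(y1,y2)) ↦ ω(x1,y1) − ω(x2,y2)`. -/
noncomputable def prodNegForm (ω : BilinForm ℝ E) : BilinForm ℝ (E × E) :=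
  LinearMap.mk₂ ℝ (fun x y => ω x.1 y.1 - ω x.2 y.2)
    (fun x x' y => by simp only [Prod.fst_add, Prod.snd_add, map_add, LinearMap.add_apply]; ring)
    (fun c x y => by
      simp only [Prod.smul_fst, Prod.smul_snd, map_smul, LinearMap.smul_apply, smul_eq_mul]; ring)
    (fun x y y' => by simp only [Prod.fst_add, Prod.snd_add, map_add]; ring)
    (fun c x y => by simp only [Prod.smul_fst, Prod.smul_snd, map_smul, smul_eq_mul]; ring)

/-- The graph `Γ_A = {(A x, x)}` of an endomorphism, as a subspace of `E × E`. -/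
def graphSub (A : E →L[ℝ] E) : Submodule ℝ (E × E) :=
  LinearMap.range ((A : E →ₗ[ℝ] E).prod LinearMap.id)

/-- The diagonal `Δ = {(x, x)}` in `E × E`. -/
def diagSub : Submodule ℝ (E × E) :=
  LinearMap.range ((LinearMap.id : E →ₗ[ℝ] E).prod LinearMap.id)

theorem posIndex_eq_sigPos {V : Type*} [AddCommGroup V] [Module ℝ V] [FiniteDimensional ℝ V]
    (Q : QuadraticForm ℝ V) : posIndex Q = sigPos Q := by
  refine IsGreatest.csSup_eq ?_
  convert! sigPos_isGreatest Q using 6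
  simp [QuadraticMap.PosDef]

theorem posIndex_comp_linearEquiv {V W : Type*} [AddCommGroup V] [Module ℝ V]
    [AddCommGroup W] [Module ℝ W] (e : V ≃ₗ[ℝ] W) (Q : W → ℝ) :
    posIndex (fun v => Q (e v)) = posIndex Q := by
  unfold posIndex
  congr 1
  ext d
  constructor
  · rintro ⟨U, hU, hQ⟩
    refine ⟨U.map (e : V →ₗ[ℝ] W), by rw [← hU]; exact e.finrank_map_eq U, ?_⟩
    rintro _ ⟨x, hx, rfl⟩ hne
    exact hQ x hx (by rintro rfl; simp at hne)
  · rintro ⟨U, hU, hQ⟩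
    refine ⟨U.map (e.symm : W →ₗ[ℝ] V), by rw [← hU]; exact e.symm.finrank_map_eq U, ?_⟩
    rintro _ ⟨x, hx, rfl⟩ hne
    simpa using hQ x hx (by rintro rfl; simp at hne)

theorem Submodule.finrank_prod_eq_add {V W : Type*} [AddCommGroup V] [Module ℝ V]
    [AddCommGroup W] [Module ℝ W] [FiniteDimensional ℝ V] [FiniteDimensional ℝ W]
    (p : Submodule ℝ V) (q : Submodule ℝ W) :
    Module.finrank ℝ (p.prod q) = Module.finrank ℝ p + Module.finrank ℝ q := by
  have h : LinearMap.range (p.subtype.prodMap q.subtype) = p.prod q := by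
    rw [LinearMap.range_prodMap, p.range_subtype, q.range_subtype]
  rw [← h, LinearMap.finrank_range_of_inj, Module.finrank_prod]
  exact Function.Injective.prodMap p.injective_subtype q.injective_subtype

namespace QuadraticForm

theorem neg_prod {V W : Type*} [AddCommGroup V] [Module ℝ V] [AddCommGroup W] [Module ℝ W]
    (P : QuadraticForm ℝ V) (Q : QuadraticForm ℝ W) :
    -(QuadraticMap.prod P Q) = QuadraticMap.prod (-P) (-Q) := by
  ext x
  simp [add_comm]

variable {V W : Type*} [AddCommGroup V] [Module ℝ V] [FiniteDimensional ℝ V]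
    [AddCommGroup W] [Module ℝ W] [FiniteDimensional ℝ W]

theorem sigPos_add_sigPos_le_sigPos_prod (P : QuadraticForm ℝ V) (Q : QuadraticForm ℝ W) :
    sigPos P + sigPos Q ≤ sigPos (QuadraticMap.prod P Q) := by
  obtain ⟨p, hp, hP⟩ := exists_finrank_eq_sigPos_and_posDef P
  obtain ⟨q, hq, hQ⟩ := exists_finrank_eq_sigPos_and_posDef Q
  rw [← hp, ← hq, ← Submodule.finrank_prod_eq_add]
  refine le_sigPos_of_posDef _ ?_
  rintro ⟨⟨x, y⟩, hx, hy⟩ hne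
  have h1 := hP.nonneg ⟨x, hx⟩
  have h2 := hQ.nonneg ⟨y, hy⟩
  simp only [QuadraticMap.restrict_apply, QuadraticMap.prod_apply] at h1 h2 ⊢
  by_cases h : x = 0
  · have := hQ ⟨y, hy⟩ (by rintro h'; simp_all)
    simp only [QuadraticMap.restrict_apply] at this
    linarith
  · have := hP ⟨x, hx⟩ (by simpa using h)
    simp only [QuadraticMap.restrict_apply] at this
    linarith

theorem sigPos_prod (P : QuadraticForm ℝ V) (Q : QuadraticForm ℝ W) :
    sigPos (QuadraticMap.prod P Q) = sigPos P + sigPos Q := by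
  have h1 := sigPos_add_sigPos_le_sigPos_prod P Q
  have h2 := sigPos_add_sigPos_le_sigPos_prod (-P) (-Q)
  rw [← neg_prod] at h2
  simp only [sigPos_neg] at h2
  have h3 : Module.finrank ℝ P.radical + Module.finrank ℝ Q.radical ≤
      Module.finrank ℝ (QuadraticMap.prod P Q).radical := by
    rw [← Submodule.finrank_prod_eq_add]
    refine Submodule.finrank_mono ?_
    rintro ⟨x, y⟩ ⟨hx, hy⟩
    rw [SetLike.mem_coe, QuadraticMap.mem_radical_iff'] at hx hy
    rw [QuadraticMap.mem_radical_iff']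
    simp_all
  have := sigPos_add_sigNeg_add_radical (Q := P)
  have := sigPos_add_sigNeg_add_radical (Q := Q)
  have := sigPos_add_sigNeg_add_radical (Q := QuadraticMap.prod P Q)
  rw [Module.finrank_prod] at this
  lia

/-- The signature of a real quadratic form. -/
noncomputable def signature (Q : QuadraticForm ℝ V) : ℤ := sigPos Q - sigNeg Q

theorem signature_prod (P : QuadraticForm ℝ V) (Q : QuadraticForm ℝ W) :
    signature (QuadraticMap.prod P Q) = signature P + signature Q := by
  simp only [signature, ← sigPos_neg, neg_prod, sigPos_prod]
  push_cast
  ring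

theorem signature_eq_posIndex (Q : QuadraticForm ℝ V) :
    signature Q = (posIndex Q : ℤ) - posIndex (fun v => - Q v) := by
  rw [posIndex_eq_sigPos]
  have := posIndex_eq_sigPos (-Q)
  rw [sigPos_neg] at this
  rw [signature, ← this]
  rfl

/-- The signature is locally constant at a nondegenerate form. -/
theorem eventually_signature_eq {V : Type*} [NormedAddCommGroup V] [NormedSpace ℝ V]
    [FiniteDimensional ℝ V] {ι : Type*} {l : Filter ι} {Q : ι → QuadraticForm ℝ V}
    {Q₀ : QuadraticForm ℝ V}
    (hQ : ∀ x, Filter.Tendsto (fun p : ι × V => Q p.1 p.2) (l ×ˢ nhds x) (nhds (Q₀ x)))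
    (h₀ : Q₀.radical = ⊥) :
    ∀ᶠ i in l, signature (Q i) = signature Q₀ := by
  have key : ∀ (R : ι → QuadraticForm ℝ V) (R₀ : QuadraticForm ℝ V),
      (∀ x, Filter.Tendsto (fun p : ι × V => R p.1 p.2) (l ×ˢ nhds x) (nhds (R₀ x))) →
      ∀ᶠ i in l, sigPos R₀ ≤ sigPos (R i) := by
    intro R R₀ hR
    obtain ⟨p, hp, hP⟩ := exists_finrank_eq_sigPos_and_posDef R₀
    have hK : IsCompact (Metric.sphere (0 : V) 1 ∩ p) :=
      (isCompact_sphere 0 1).inter_right p.closed_of_finiteDimensional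
    have hpos : {z : ι × V | 0 < R z.1 z.2} ∈
        l ×ˢ nhdsSet (Metric.sphere (0 : V) 1 ∩ p) := by
      refine hK.mem_prod_nhdsSet_of_forall ?_
      rintro x ⟨hx1, hxp⟩
      refine (hR x).eventually_const_lt ?_
      refine hP ⟨x, hxp⟩ ?_
      rintro h
      simp only [Submodule.mk_eq_zero] at h
      simp [h] at hx1
    rw [← hp]
    obtain ⟨s, hs, u, hu, hsu⟩ := Filter.mem_prod_iff.1 hpos
    filter_upwards [hs] with i hi
    refine le_sigPos_of_posDef _ ?_
    rintro ⟨x, hx⟩ hne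
    have hne' : x ≠ 0 := by simpa using hne
    have hmem : (‖x‖⁻¹ • x) ∈ Metric.sphere (0 : V) 1 ∩ p := by
      refine ⟨?_, p.smul_mem _ hx⟩
      simp [norm_smul, hne']
    have := hsu (Set.mk_mem_prod hi (subset_of_mem_nhdsSet hu hmem))
    simp only [Set.mem_ofPred_eq, QuadraticMap.map_smul, smul_eq_mul] at this
    rw [QuadraticMap.restrict_apply]
    exact pos_of_mul_pos_right this (mul_self_nonneg _)
  have h1 := key Q Q₀ hQ
  have h2 := key (fun i => -Q i) (-Q₀) fun x => by simpa using (hQ x).neg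
  filter_upwards [h1, h2] with i hi1 hi2
  simp only [sigPos_neg] at hi2
  have e1 := sigPos_add_sigNeg_add_radical (Q := Q₀)
  have e2 := sigPos_add_sigNeg_add_radical (Q := Q i)
  rw [h₀, finrank_bot] at e1
  simp only [signature]
  lia

end QuadraticForm

namespace IsLagrangian

variable {ω : BilinForm ℝ E} {K L : Submodule ℝ E}

theorem mem_iff (h : IsLagrangian ω L) {y : E} : y ∈ L ↔ ∀ x ∈ L, ω x y = 0 := by
  rw [IsLagrangian] at h
  conv_lhs => rw [← h]
  exact LinearMap.BilinForm.mem_orthogonal_iff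

theorem apply_eq_zero (h : IsLagrangian ω L) {x y : E} (hx : x ∈ L) (hy : y ∈ L) :
    ω x y = 0 :=
  h.mem_iff.1 hy x hx

theorem map_of_bijective (h : IsLagrangian ω L) {A : E →L[ℝ] E} (hA : Function.Bijective A)
    (hω : ∀ x y, ω (A x) (A y) = ω x y) : IsLagrangian ω (L.map (A : E →ₗ[ℝ] E)) := by
  rw [IsLagrangian]
  ext y
  obtain ⟨y, rfl⟩ := hA.2 y
  rw [LinearMap.BilinForm.mem_orthogonal_iff]
  have : A y ∈ L.map (A : E →ₗ[ℝ] E) ↔ y ∈ L :=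
    ⟨fun ⟨z, hz, hzy⟩ => hA.1 hzy ▸ hz, fun hy => ⟨y, hy, rfl⟩⟩
  rw [this, h.mem_iff]
  constructor
  · intro H x hx
    rw [← hω]
    exact H _ ⟨x, hx, rfl⟩
  · rintro H _ ⟨x, hx, rfl⟩
    exact (hω x y).trans (H x hx)

variable [FiniteDimensional ℝ E]

theorem two_mul_finrank (hnd : LinearMap.BilinForm.Nondegenerate ω) (h : IsLagrangian ω L) :
    2 * Module.finrank ℝ L = Module.finrank ℝ E := by
  have h1 := LinearMap.BilinForm.finrank_orthogonal hnd L
  rw [IsLagrangian] at h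
  rw [h] at h1
  have := Submodule.finrank_le L
  lia

theorem isCompl (hnd : LinearMap.BilinForm.Nondegenerate ω) (hK : IsLagrangian ω K)
    (hL : IsLagrangian ω L) (h : Disjoint K L) : IsCompl K L := by
  refine ⟨h, codisjoint_iff.2 (Submodule.eq_top_of_finrank_eq ?_)⟩
  have h1 := Submodule.finrank_sup_add_finrank_inf_eq K L
  rw [h.eq_bot, finrank_bot] at h1
  have := hK.two_mul_finrank hnd
  have := hL.two_mul_finrank hnd
  lia

/-- Finitely many Lagrangian subspaces (at least one) have a common Lagrangian complement. -/
theorem exists_forall_disjoint (halt : LinearMap.IsAlt ω)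
    (hnd : LinearMap.BilinForm.Nondegenerate ω) {ι : Type*} [Finite ι] [Nonempty ι]
    {L : ι → Submodule ℝ E} (hL : ∀ i, IsLagrangian ω (L i)) :
    ∃ K, IsLagrangian ω K ∧ ∀ i, Disjoint K (L i) := by
  have hrefl : ω.IsRefl := halt.isRefl
  let S : Set (Submodule ℝ E) := {K | K ≤ ω.orthogonal K ∧ ∀ i, Disjoint K (L i)}
  have hS : S.Nonempty := ⟨⊥, bot_le, fun i => disjoint_bot_left⟩
  obtain ⟨K, ⟨hK, hKL⟩, hmax⟩ := WellFounded.has_min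
    (wellFounded_gt : WellFounded ((· > ·) : Submodule ℝ E → Submodule ℝ E → Prop)) S hS
  refine ⟨K, ?_, hKL⟩
  by_contra hne
  have hproper : ∀ i, (K ⊔ L i).comap (ω.orthogonal K).subtype ≠ ⊤ := by
    intro i htop
    rw [Submodule.comap_subtype_eq_top] at htop
    refine hne (le_antisymm ?_ hK)
    have hdual : L i ⊓ ω.orthogonal K ≤ K := by
      intro x hx
      rw [← LinearMap.BilinForm.orthogonal_orthogonal hnd hrefl K,
        LinearMap.BilinForm.mem_orthogonal_iff]
      intro y hy
      obtain ⟨k, hk, z, hz, rfl⟩ := Submodule.mem_sup.1 (htop hy)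
      have h1 : ω k x = 0 := LinearMap.BilinForm.mem_orthogonal_iff.1 hx.2 k hk
      have h2 : ω z x = 0 := (hL i).apply_eq_zero hz hx.1
      simp [h1, h2]
    intro y hy
    obtain ⟨k, hk, z, hz, rfl⟩ := Submodule.mem_sup.1 (htop hy)
    have hz' : z ∈ ω.orthogonal K := by
      simpa using (ω.orthogonal K).sub_mem hy (hK hk)
    exact K.add_mem hk (hdual ⟨hz, hz'⟩)
  have hcov : (⋃ i, (((K ⊔ L i).comap (ω.orthogonal K).subtype : Submodule ℝ _) :
      Set (ω.orthogonal K))) ≠ Set.univ := fun h =>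
    let ⟨i, hi⟩ := Subspace.exists_eq_top_of_iUnion_eq_univ h
    hproper i hi
  obtain ⟨⟨x, hxK⟩, hx⟩ := (Set.ne_univ_iff_exists_notMem _).1 hcov
  simp only [Set.mem_iUnion, not_exists, SetLike.mem_coe, Submodule.mem_comap,
    Submodule.subtype_apply] at hx
  have hxK' : x ∉ K := fun h => hx (Classical.arbitrary ι) (Submodule.mem_sup_left h)
  refine hmax (K ⊔ ℝ ∙ x) ⟨?_, fun i => ?_⟩ ?_
  · intro y hy
    obtain ⟨k, hk, z, hz, rfl⟩ := Submodule.mem_sup.1 hy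
    obtain ⟨c, rfl⟩ := Submodule.mem_span_singleton.1 hz
    rw [LinearMap.BilinForm.mem_orthogonal_iff]
    intro w hw
    obtain ⟨k', hk', z', hz', rfl⟩ := Submodule.mem_sup.1 hw
    obtain ⟨c', rfl⟩ := Submodule.mem_span_singleton.1 hz'
    have h1 : ω k' k = 0 := LinearMap.BilinForm.mem_orthogonal_iff.1 (hK hk) k' hk'
    have h2 : ω k' x = 0 := LinearMap.BilinForm.mem_orthogonal_iff.1 hxK k' hk'
    have h3 : ω x k = 0 := hrefl _ _ (LinearMap.BilinForm.mem_orthogonal_iff.1 hxK k hk)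
    simp [h1, h2, h3, halt x]
  · rw [Submodule.disjoint_def]
    intro y hy hyL
    obtain ⟨k, hk, z, hz, rfl⟩ := Submodule.mem_sup.1 hy
    obtain ⟨c, rfl⟩ := Submodule.mem_span_singleton.1 hz
    rcases eq_or_ne c 0 with rfl | hc
    · simp only [zero_smul, add_zero] at hyL ⊢
      exact Submodule.disjoint_def.1 (hKL i) k hk hyL
    · refine absurd ?_ (hx i)
      have : x = c⁻¹ • (-k + (k + c • x)) := by simp [smul_smul, hc]
      rw [this]
      exact Submodule.smul_mem _ _ (Submodule.add_mem_sup (K.neg_mem hk) hyL)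
  · refine lt_of_le_of_ne le_sup_left fun h => hxK' ?_
    rw [h]
    exact Submodule.mem_sup_right (Submodule.mem_span_singleton_self x)

end IsLagrangian

/-- `σ : V → E` parametrizes the subspace `L` as a graph over the subspace `V` with values
in the subspace `K`. -/
structure IsGraphParam (K V L : Submodule ℝ E) (σ : V →L[ℝ] E) : Prop where
  range_eq : LinearMap.range (σ : V →ₗ[ℝ] E) = L
  sub_mem : ∀ x, σ x - x ∈ K

namespace IsGraphParam

variable {K V L L' : Submodule ℝ E} {σ σ' : V →L[ℝ] E}

theorem mem (h : IsGraphParam K V L σ) (x : V) : σ x ∈ L :=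
  h.range_eq ▸ ⟨x, rfl⟩

theorem exists_eq (h : IsGraphParam K V L σ) {y : E} (hy : y ∈ L) : ∃ x, σ x = y := by
  rw [← h.range_eq] at hy
  exact hy

theorem injective (hKV : Disjoint K V) (h : IsGraphParam K V L σ) : Function.Injective σ := by
  rw [injective_iff_map_eq_zero]
  intro x hx
  have h1 := h.sub_mem x
  rw [hx, zero_sub, K.neg_mem_iff] at h1
  exact Subtype.ext (Submodule.disjoint_def.1 hKV x h1 x.2)

/-- The parametrization as a linear equivalence. -/
noncomputable def equiv (hKV : Disjoint K V) (h : IsGraphParam K V L σ) : V ≃ₗ[ℝ] L :=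
  (LinearEquiv.ofInjective (σ : V →ₗ[ℝ] E) (h.injective hKV)).trans
    (LinearEquiv.ofEq _ _ h.range_eq)

theorem sub_sub_mem (h : IsGraphParam K V L σ) (h' : IsGraphParam K V L' σ') (x : V) :
    σ x - σ' x ∈ K := by
  simpa using K.sub_mem (h.sub_mem x) (h'.sub_mem x)

end IsGraphParam

/-- The form `(x, y) ↦ ω(σ x, τ y)`; it is symmetric if `σ` and `τ` parametrize Lagrangian
subspaces as graphs. -/
noncomputable def pairForm (ω : BilinForm ℝ E) {V : Submodule ℝ E} (σ τ : V →L[ℝ] E) :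
    BilinForm ℝ V :=
  ω.compl₁₂ (σ : V →ₗ[ℝ] E) (τ : V →ₗ[ℝ] E)

theorem pairForm_apply (ω : BilinForm ℝ E) {V : Submodule ℝ E} (σ τ : V →L[ℝ] E) (x y : V) :
    pairForm ω σ τ x y = ω (σ x) (τ y) := rfl

section pairForm

variable {ω : BilinForm ℝ E} {K V L₁ L₂ L₃ : Submodule ℝ E} {σ₁ σ₂ σ₃ : V →L[ℝ] E}

theorem pairForm_swap (halt : LinearMap.IsAlt ω) (σ τ : V →L[ℝ] E) (x y : V) :
    pairForm ω σ τ x y = - pairForm ω τ σ y x :=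
  (halt.neg _ _).symm

theorem pairForm_comm (halt : LinearMap.IsAlt ω) (hK : IsLagrangian ω K)
    (hL₁ : IsLagrangian ω L₁) (hL₂ : IsLagrangian ω L₂)
    (h₁ : IsGraphParam K V L₁ σ₁) (h₂ : IsGraphParam K V L₂ σ₂) (x y : V) :
    pairForm ω σ₁ σ₂ x y = pairForm ω σ₁ σ₂ y x := by
  have h := hK.apply_eq_zero (h₁.sub_sub_mem h₂ x) (h₁.sub_sub_mem h₂ y)
  have e1 := hL₁.apply_eq_zero (h₁.mem x) (h₁.mem y)
  have e2 := hL₂.apply_eq_zero (h₂.mem x) (h₂.mem y)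
  have e3 := halt.neg (σ₁ y) (σ₂ x)
  simp only [map_sub, LinearMap.sub_apply] at h
  simp only [pairForm_apply]
  linarith

theorem pairForm_add_add (halt : LinearMap.IsAlt ω) (hK : IsLagrangian ω K)
    (hL₁ : IsLagrangian ω L₁) (hL₂ : IsLagrangian ω L₂) (hL₃ : IsLagrangian ω L₃)
    (h₁ : IsGraphParam K V L₁ σ₁) (h₂ : IsGraphParam K V L₂ σ₂) (h₃ : IsGraphParam K V L₃ σ₃)
    (x y : V) :
    pairForm ω σ₁ σ₂ x y + pairForm ω σ₂ σ₃ x y + pairForm ω σ₃ σ₁ x y = 0 := by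
  have h := hK.apply_eq_zero (h₁.sub_sub_mem h₃ x) (h₂.sub_sub_mem h₃ y)
  have e3 := hL₃.apply_eq_zero (h₃.mem x) (h₃.mem y)
  have c1 := pairForm_comm halt hK hL₃ hL₁ h₃ h₁ x y
  have c2 := pairForm_comm halt hK hL₂ hL₃ h₂ h₃ x y
  rw [pairForm_swap halt, pairForm_apply] at c1 c2
  simp only [map_sub, LinearMap.sub_apply] at h
  simp only [pairForm_apply] at *
  have e4 := halt.neg (σ₁ x) (σ₃ y)
  have e5 := halt.neg (σ₁ y) (σ₃ x)
  have e6 := halt.neg (σ₂ x) (σ₃ y)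
  have e7 := halt.neg (σ₂ y) (σ₃ x)
  linarith

/-- The change of variables `(α, β, γ) ↦ (α + γ, α + β, β + γ)`. -/
noncomputable def cyclicSumEquiv (V : Type*) [AddCommGroup V] [Module ℝ V] :
    (V × V × V) ≃ₗ[ℝ] (V × V × V) where
  toFun v := (v.1 + v.2.2, v.1 + v.2.1, v.2.1 + v.2.2)
  invFun v := ((1 / 2 : ℝ) • (v.1 + v.2.1 - v.2.2), (1 / 2 : ℝ) • (v.2.1 + v.2.2 - v.1),
    (1 / 2 : ℝ) • (v.2.2 + v.1 - v.2.1))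
  map_add' u v := by ext <;> simp <;> abel
  map_smul' c v := by ext <;> simp
  left_inv v := by ext <;> simp <;> module
  right_inv v := by ext <;> simp <;> module

/-- The signature of a triple of Lagrangian subspaces that have a common Lagrangian complement. -/
theorem tripleSig_eq_add_add [FiniteDimensional ℝ E] (halt : LinearMap.IsAlt ω)
    (hK : IsLagrangian ω K) (hKV : Disjoint K V)
    (hL₁ : IsLagrangian ω L₁) (hL₂ : IsLagrangian ω L₂) (hL₃ : IsLagrangian ω L₃)
    (h₁ : IsGraphParam K V L₁ σ₁) (h₂ : IsGraphParam K V L₂ σ₂)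
    (h₃ : IsGraphParam K V L₃ σ₃) :
    tripleSig ω L₁ L₂ L₃ =
      QuadraticForm.signature (pairForm ω σ₁ σ₂).toQuadraticMap +
      (QuadraticForm.signature (pairForm ω σ₂ σ₃).toQuadraticMap +
      QuadraticForm.signature (pairForm ω σ₃ σ₁).toQuadraticMap) := by
  let e : (V × V × V) ≃ₗ[ℝ] (L₁ × L₂ × L₃) := (cyclicSumEquiv V).trans
    ((h₁.equiv hKV).prodCongr ((h₂.equiv hKV).prodCongr (h₃.equiv hKV)))
  let Q : QuadraticForm ℝ (V × V × V) := QuadraticMap.prod (pairForm ω σ₁ σ₂).toQuadraticMap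
    (QuadraticMap.prod (pairForm ω σ₂ σ₃).toQuadraticMap (pairForm ω σ₃ σ₁).toQuadraticMap)
  have hQ : ∀ v, tripleQ ω L₁ L₂ L₃ (e v) = Q v := by
    rintro ⟨x, y, z⟩
    have hl : tripleQ ω L₁ L₂ L₃ (e (x, y, z)) = pairForm ω σ₁ σ₂ (x + z) (x + y) +
      pairForm ω σ₂ σ₃ (x + y) (y + z) + pairForm ω σ₃ σ₁ (y + z) (x + z) := rfl
    have hr : Q (x, y, z) = pairForm ω σ₁ σ₂ x x +
      (pairForm ω σ₂ σ₃ y y + pairForm ω σ₃ σ₁ z z) := rfl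
    rw [hl, hr]
    simp only [map_add, LinearMap.add_apply]
    have H := pairForm_add_add halt hK hL₁ hL₂ hL₃ h₁ h₂ h₃
    have c₁ := pairForm_comm halt hK hL₁ hL₂ h₁ h₂
    have c₂ := pairForm_comm halt hK hL₂ hL₃ h₂ h₃
    have c₃ := pairForm_comm halt hK hL₃ hL₁ h₃ h₁
    linarith [H x y, H x z, H y z, c₁ x y, c₁ x z, c₁ y z, c₂ x y, c₂ x z, c₂ y z, c₃ x y, c₃ x z,
      c₃ y z]
  rw [← QuadraticForm.signature_prod, ← QuadraticForm.signature_prod,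
    QuadraticForm.signature_eq_posIndex, tripleSig, ← posIndex_comp_linearEquiv e,
    ← posIndex_comp_linearEquiv e (fun v => - tripleQ ω L₁ L₂ L₃ v)]
  simp only [hQ]
  rfl

theorem radical_pairForm (halt : LinearMap.IsAlt ω) (hK : IsLagrangian ω K) (hKV : Disjoint K V)
    (hL₁ : IsLagrangian ω L₁) (hL₂ : IsLagrangian ω L₂) (h : Disjoint L₁ L₂)
    (h₁ : IsGraphParam K V L₁ σ₁) (h₂ : IsGraphParam K V L₂ σ₂) :
    (pairForm ω σ₁ σ₂).toQuadraticMap.radical = ⊥ := by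
  rw [eq_bot_iff]
  intro x hx
  have hx' := QuadraticMap.radical_le_ker_polarBilin hx
  rw [LinearMap.mem_ker] at hx'
  have hzero : ∀ y, ω (σ₁ x) (σ₂ y) = 0 := by
    intro y
    have h3 := LinearMap.congr_fun hx' y
    rw [QuadraticMap.polarBilin_apply_apply, LinearMap.BilinMap.polar_toQuadraticMap,
      pairForm_comm halt hK hL₁ hL₂ h₁ h₂ y x, pairForm_apply, LinearMap.zero_apply] at h3
    linarith
  have hmem : σ₁ x ∈ L₂ := hL₂.mem_iff.2 fun z hz => by
    obtain ⟨y, rfl⟩ := h₂.exists_eq hz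
    rw [← halt.neg, hzero, neg_zero]
  have := Submodule.disjoint_def.1 h _ (h₁.mem x) hmem
  exact (injective_iff_map_eq_zero σ₁).1 (h₁.injective hKV) x this

theorem eventually_signature_pairForm_eq [FiniteDimensional ℝ E]
    (halt : LinearMap.IsAlt ω) (hK : IsLagrangian ω K)
    (hKV : Disjoint K V) (hL₁ : IsLagrangian ω L₁) (hL₂ : IsLagrangian ω L₂)
    (h : Disjoint L₁ L₂) (h₁ : IsGraphParam K V L₁ σ₁) (h₂ : IsGraphParam K V L₂ σ₂)
    {ι : Type*} {l : Filter ι} {σ τ : ι → V →L[ℝ] E} (hσ : Filter.Tendsto σ l (nhds σ₁))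
    (hτ : Filter.Tendsto τ l (nhds σ₂)) :
    ∀ᶠ i in l, QuadraticForm.signature (pairForm ω (σ i) (τ i)).toQuadraticMap =
      QuadraticForm.signature (pairForm ω σ₁ σ₂).toQuadraticMap := by
  refine QuadraticForm.eventually_signature_eq (fun x => ?_)
    (radical_pairForm halt hK hKV hL₁ hL₂ h h₁ h₂)
  have happ : ∀ {ρ : ι → V →L[ℝ] E} {ρ₀ : V →L[ℝ] E}, Filter.Tendsto ρ l (nhds ρ₀) →
      Filter.Tendsto (fun p : ι × V => ρ p.1 p.2) (l ×ˢ nhds x) (nhds (ρ₀ x)) := fun hρ =>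
    (isBoundedBilinearMap_apply.continuous.tendsto (_, x)).comp
      ((hρ.comp Filter.tendsto_fst).prodMk_nhds Filter.tendsto_snd)
  have hω : Continuous fun p : E × E => LinearMap.toContinuousBilinearMap ω p.1 p.2 := by
    fun_prop
  exact (hω.tendsto (σ₁ x, σ₂ x)).comp ((happ hσ).prodMk_nhds (happ hτ))

end pairForm

namespace IsLagrangianPath

variable {ω : BilinForm ℝ E} {a b : ℝ} {L L₁ L₂ : ℝ → Submodule ℝ E}

/-- A path of Lagrangian subspaces is locally parametrized by a continuous family of graphs. -/
theorem exists_isGraphParam [FiniteDimensional ℝ E]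
    (hnd : LinearMap.BilinForm.Nondegenerate ω) (h : IsLagrangianPath ω a b L) {t₀ : ℝ}
    (ht₀ : t₀ ∈ Set.Icc a b) {K V : Submodule ℝ E} (hK : IsLagrangian ω K)
    (hKL : Disjoint K (L t₀)) (hKV : IsCompl K V) :
    ∃ σ : ℝ → V →L[ℝ] E, Filter.Tendsto σ (nhdsWithin t₀ (Set.Icc a b)) (nhds (σ t₀)) ∧
      ∀ᶠ t in nhdsWithin t₀ (Set.Icc a b), IsGraphParam K V (L t) (σ t) := by
  obtain ⟨U, hU, hUI, P, hP, hPL⟩ := h.locTriv t₀ ht₀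
  have htU : t₀ ∈ U := mem_of_mem_nhdsWithin ht₀ hU
  have hPmem : ∀ t ∈ U, ∀ x, P t x ∈ L t := fun t ht x => (hPL t ht).2 ▸ ⟨x, rfl⟩
  have hPfix : ∀ t ∈ U, ∀ x ∈ L t, P t x = x := by
    intro t ht x hx
    rw [← (hPL t ht).2] at hx
    obtain ⟨y, rfl⟩ := hx
    exact DFunLike.congr_fun (hPL t ht).1 y
  have hc := (h.lag t₀ ht₀).isCompl hnd hK hKL.symm
  let π : E →L[ℝ] V := LinearMap.toContinuousLinearMap (Submodule.projectionOnto V K hKV.symm)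
  let σ₀ : V →L[ℝ] E := LinearMap.toContinuousLinearMap
    ((Submodule.projection (L t₀) K hc).comp V.subtype)
  have hσ₀ : ∀ x : V, σ₀ x ∈ L t₀ := fun x => Submodule.projection_apply_mem _ _
  have hσ₀K : ∀ x : V, σ₀ x - x ∈ K := fun x => by
    have := Submodule.sub_projection_mem hc (x : E)
    rw [← K.neg_mem_iff, neg_sub]
    exact this
  have hπ : ∀ x : E, x - π x ∈ K := fun x => Submodule.sub_projection_mem hKV.symm x
  let Φ : ℝ → V →L[ℝ] V := fun t => π.comp ((P t).comp σ₀)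
  have hΦ₀ : Φ t₀ = 1 := by
    ext x
    have e : P t₀ (σ₀ x) = σ₀ x := hPfix t₀ htU _ (hσ₀ x)
    have e₁ : π (σ₀ x - x) = 0 := (Submodule.projectionOnto_apply_eq_zero_iff hKV.symm).2 (hσ₀K x)
    have e₂ : π (x : E) = x := Submodule.projectionOnto_apply_left hKV.symm x
    rw [map_sub, e₂, sub_eq_zero] at e₁
    change ((π (P t₀ (σ₀ x)) : V) : E) = x
    rw [e, e₁]
  have hPt : ContinuousWithinAt P (Set.Icc a b) t₀ := (hP t₀ htU).mono_of_mem_nhdsWithin hU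
  have hPσ : ContinuousWithinAt (fun t => (P t).comp σ₀) (Set.Icc a b) t₀ :=
    hPt.clm_comp continuousWithinAt_const
  have hΦ : ContinuousWithinAt Φ (Set.Icc a b) t₀ := continuousWithinAt_const.clm_comp hPσ
  have hunit : IsUnit (Φ t₀) := hΦ₀ ▸ isUnit_one
  have : CompleteSpace V := FiniteDimensional.complete ℝ V
  have hinverse : ContinuousAt Ring.inverse (Φ t₀) :=
    NormedRing.inverse_continuousAt (R := V →L[ℝ] V) hunit.unit
  have hisUnit : ∀ᶠ f in nhds (Φ t₀), IsUnit f :=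
    (Units.isOpen (R := V →L[ℝ] V)).mem_nhds hunit
  refine ⟨fun t => ((P t).comp σ₀).comp (Ring.inverse (Φ t)),
    hPσ.clm_comp (hinverse.tendsto.comp hΦ), ?_⟩
  filter_upwards [hU, hΦ.tendsto.eventually hisUnit] with t ht htu
  have hinv : ∀ x, π (P t (σ₀ (Ring.inverse (Φ t) x))) = x := fun x =>
    DFunLike.congr_fun (Ring.mul_inverse_cancel _ htu) x
  have hsub : ∀ x : V, P t (σ₀ (Ring.inverse (Φ t) x)) - x ∈ K := fun x => by
    simpa only [hinv] using hπ (P t (σ₀ (Ring.inverse (Φ t) x)))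
  refine ⟨Submodule.eq_of_le_of_finrank_eq ?_ ?_, hsub⟩
  · rintro _ ⟨x, rfl⟩
    exact hPmem t ht _
  · rw [LinearMap.finrank_range_of_inj]
    · have := Submodule.finrank_add_eq_of_isCompl hKV
      have := hK.two_mul_finrank hnd
      have := (h.lag t (hUI ht)).two_mul_finrank hnd
      lia
    · exact Function.LeftInverse.injective hinv

/-- A locally defined function `g`, depending only on `L₁`, `L₂`, describes the variation of the
signature of `(L₁, L₂, M)` as long as `M` stays transverse to `L₁` and `L₂`. -/
theorem exists_eventually_tripleSig_sub_eq [FiniteDimensional ℝ E] (halt : LinearMap.IsAlt ω)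
    (hnd : LinearMap.BilinForm.Nondegenerate ω) (h₁ : IsLagrangianPath ω a b L₁)
    (h₂ : IsLagrangianPath ω a b L₂) {t₀ : ℝ} (ht₀ : t₀ ∈ Set.Icc a b) {K : Submodule ℝ E}
    (hK : IsLagrangian ω K) (hK₁ : Disjoint K (L₁ t₀)) (hK₂ : Disjoint K (L₂ t₀)) :
    ∃ g : ℝ → ℤ, ∀ M, IsLagrangianPath ω a b M → Disjoint K (M t₀) → Disjoint (M t₀) (L₁ t₀) →
      Disjoint (M t₀) (L₂ t₀) → ∀ᶠ t in nhdsWithin t₀ (Set.Icc a b),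
        tripleSig ω (L₁ t) (L₂ t) (M t) - g t =
          tripleSig ω (L₁ t₀) (L₂ t₀) (M t₀) - g t₀ := by
  obtain ⟨V, hKV⟩ := K.exists_isCompl
  obtain ⟨σ₁, hσ₁, hp₁⟩ := h₁.exists_isGraphParam hnd ht₀ hK hK₁ hKV
  obtain ⟨σ₂, hσ₂, hp₂⟩ := h₂.exists_isGraphParam hnd ht₀ hK hK₂ hKV
  refine ⟨fun t => QuadraticForm.signature (pairForm ω (σ₁ t) (σ₂ t)).toQuadraticMap,
    fun M hM hKM hM₁ hM₂ => ?_⟩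
  obtain ⟨σ, hσ, hp⟩ := hM.exists_isGraphParam hnd ht₀ hK hKM hKV
  have q₁ := hp₁.self_of_nhdsWithin ht₀
  have q₂ := hp₂.self_of_nhdsWithin ht₀
  have q := hp.self_of_nhdsWithin ht₀
  filter_upwards [hp₁, hp₂, hp, self_mem_nhdsWithin,
    eventually_signature_pairForm_eq halt hK hKV.disjoint (h₂.lag _ ht₀) (hM.lag _ ht₀) hM₂.symm
      q₂ q hσ₂ hσ,
    eventually_signature_pairForm_eq halt hK hKV.disjoint (hM.lag _ ht₀) (h₁.lag _ ht₀) hM₁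
      q q₁ hσ hσ₁] with t r₁ r₂ r ht e₁ e₂
  rw [tripleSig_eq_add_add halt hK hKV.disjoint (h₁.lag _ ht) (h₂.lag _ ht) (hM.lag _ ht) r₁ r₂ r,
    tripleSig_eq_add_add halt hK hKV.disjoint (h₁.lag _ ht₀) (h₂.lag _ ht₀) (hM.lag _ ht₀)
      q₁ q₂ q, e₁, e₂]
  ring

theorem map (h : IsLagrangianPath ω a b L) [FiniteDimensional ℝ E] {A : ℝ → E →L[ℝ] E}
    (hA : IsSymplecticPath ω a b A) :
    IsLagrangianPath ω a b (fun t => (L t).map (A t : E →ₗ[ℝ] E)) := by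
  refine ⟨fun t ht => (h.lag t ht).map_of_bijective (hA.bij t ht) (hA.symp t ht),
    fun t₀ ht₀ => ?_⟩
  obtain ⟨U, hU, hUI, P, hP, hPL⟩ := h.locTriv t₀ ht₀
  have : CompleteSpace E := FiniteDimensional.complete ℝ E
  have hunit : ∀ t ∈ U, IsUnit (A t) := fun t ht =>
    ContinuousLinearMap.isUnit_iff_bijective.2 (hA.bij t (hUI ht))
  have hl : ∀ t ∈ U, ∀ x, Ring.inverse (A t) (A t x) = x := fun t ht x =>
    DFunLike.congr_fun (Ring.inverse_mul_cancel _ (hunit t ht)) x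
  refine ⟨U, hU, hUI, fun t => ((A t).comp (P t)).comp (Ring.inverse (A t)), ?_, ?_⟩
  · refine ((hA.cont.mono hUI).clm_comp hP).clm_comp fun t ht => ?_
    exact (NormedRing.inverse_continuousAt (hunit t ht).unit).tendsto.comp
      (hA.cont.mono hUI t ht)
  · intro t ht
    obtain ⟨h₁, h₂⟩ := hPL t ht
    constructor
    · ext x
      simp only [ContinuousLinearMap.comp_apply, hl t ht]
      exact congrArg (A t) (DFunLike.congr_fun h₁ _)
    · rw [← h₂]
      ext y
      constructor
      · rintro ⟨x, rfl⟩
        exact ⟨_, ⟨_, rfl⟩, rfl⟩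
      · rintro ⟨_, ⟨x, rfl⟩, rfl⟩
        refine ⟨A t x, ?_⟩
        simp [hl t ht]

theorem const [FiniteDimensional ℝ E] {M : Submodule ℝ E} (hM : IsLagrangian ω M) :
    IsLagrangianPath ω a b (fun _ => M) := by
  obtain ⟨N, hN⟩ := M.exists_isCompl
  refine ⟨fun _ _ => hM, fun t₀ _ => ⟨_, self_mem_nhdsWithin, subset_rfl,
    fun _ => LinearMap.toContinuousLinearMap (Submodule.projection M N hN),
    continuousOn_const, fun t _ => ⟨?_, ?_⟩⟩⟩
  · ext x
    exact DFunLike.congr_fun (Submodule.isIdempotentElem_projection hN) x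
  · exact Submodule.range_projection hN

end IsLagrangianPath

theorem tripleSig_map {ω : BilinForm ℝ E} {A : E →L[ℝ] E} (hA : Function.Injective A)
    (hω : ∀ x y, ω (A x) (A y) = ω x y) (L₁ L₂ L₃ : Submodule ℝ E) :
    tripleSig ω (L₁.map (A : E →ₗ[ℝ] E)) (L₂.map (A : E →ₗ[ℝ] E)) (L₃.map (A : E →ₗ[ℝ] E)) =
      tripleSig ω L₁ L₂ L₃ := by
  let e (L : Submodule ℝ E) := Submodule.equivMapOfInjective (A : E →ₗ[ℝ] E) hA L
  have he : ∀ v, tripleQ ω (L₁.map (A : E →ₗ[ℝ] E)) (L₂.map (A : E →ₗ[ℝ] E))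
      (L₃.map (A : E →ₗ[ℝ] E)) ((e L₁).prodCongr ((e L₂).prodCongr (e L₃)) v) =
      tripleQ ω L₁ L₂ L₃ v := by
    intro v
    simp [tripleQ, e, hω]
  rw [tripleSig, ← posIndex_comp_linearEquiv ((e L₁).prodCongr ((e L₂).prodCongr (e L₃))),
    ← posIndex_comp_linearEquiv ((e L₁).prodCongr ((e L₂).prodCongr (e L₃))) (fun v => - _)]
  simp only [he]
  rfl

/-- The sum of the values of `s ν` at the projection of `t` to `[τ ν, τ (ν + 1)]`, for `ν < k`. -/
noncomputable def clampSum (τ : ℕ → ℝ) (k : ℕ) (s : ℕ → ℝ → ℤ) (t : ℝ) : ℤ :=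
  ∑ ν ∈ Finset.range k, s ν (max (τ ν) (min t (τ (ν + 1))))

section clampSum

variable {τ τ' : ℕ → ℝ} {k k' : ℕ} {s s' : ℕ → ℝ → ℤ} {a b : ℝ}

theorem le_apply_of_forall_le_succ (h : ∀ ν < k, τ ν ≤ τ (ν + 1)) {i j : ℕ} (hij : i ≤ j)
    (hj : j ≤ k) : τ i ≤ τ j := by
  induction j, hij using Nat.le_induction with
  | base => exact le_rfl
  | succ j _ ih => exact (ih (by lia)).trans (h j (by lia))

theorem clampSum_const (hτ : ∀ ν < k, τ ν ≤ τ (ν + 1)) (g : ℝ → ℤ) (t : ℝ) :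
    clampSum τ k (fun _ => g) t =
      g (max (τ 0) (min t (τ k))) - g (τ 0) + ∑ ν ∈ Finset.range k, g (τ ν) := by
  induction k with
  | zero => simp [clampSum]
  | succ k ih =>
    have h₀ : τ 0 ≤ τ k := le_apply_of_forall_le_succ hτ k.zero_le k.le_succ
    have h₁ := hτ k k.lt_succ_self
    have := ih fun ν hν => hτ ν (hν.trans k.lt_succ_self)
    rw [clampSum] at this ⊢
    rw [Finset.sum_range_succ, this, Finset.sum_range_succ]
    rcases le_total t (τ k) with ht | ht
    · rw [min_eq_left ht, min_eq_left (ht.trans h₁), max_eq_left ht]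
      ring
    · rw [min_eq_right ht, max_eq_right h₀, max_eq_right (le_min ht h₁),
        max_eq_right (h₀.trans (le_min ht h₁))]
      ring

theorem eventually_clampSum_sub_eq (hτ : ∀ ν < k, τ ν ≤ τ (ν + 1)) (ha : τ 0 = a) (hb : τ k = b)
    {t₀ : ℝ} (ht₀ : t₀ ∈ Set.Icc a b) {g : ℝ → ℤ}
    (hs : ∀ ν < k, t₀ ∈ Set.Icc (τ ν) (τ (ν + 1)) →
      ∀ᶠ t in nhdsWithin t₀ (Set.Icc a b), s ν t - g t = s ν t₀ - g t₀) :
    ∀ᶠ t in nhdsWithin t₀ (Set.Icc a b),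
      clampSum τ k s t - g t = clampSum τ k s t₀ - g t₀ := by
  have key : ∀ t ∈ Set.Icc a b, clampSum τ k s t - g t =
      clampSum τ k (fun ν t => s ν t - g t) t + (∑ ν ∈ Finset.range k, g (τ ν) - g a) := by
    intro t ht
    have := clampSum_const hτ g t
    rw [ha, hb, min_eq_left ht.2, max_eq_right ht.1] at this
    have e : clampSum τ k (fun ν t => s ν t - g t) t =
        clampSum τ k s t - clampSum τ k (fun _ => g) t := Finset.sum_sub_distrib _ _
    rw [e, this]
    ring
  have hev : ∀ ν ∈ Finset.range k, ∀ᶠ t in nhdsWithin t₀ (Set.Icc a b),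
      s ν (max (τ ν) (min t (τ (ν + 1)))) - g (max (τ ν) (min t (τ (ν + 1)))) =
        s ν (max (τ ν) (min t₀ (τ (ν + 1)))) - g (max (τ ν) (min t₀ (τ (ν + 1)))) := by
    intro ν hν
    rw [Finset.mem_range] at hν
    have h₁ := hτ ν hν
    rcases lt_or_ge t₀ (τ ν) with hlt | hge
    · filter_upwards [mem_nhdsWithin_of_mem_nhds (Iio_mem_nhds hlt)] with t ht
      rw [max_eq_left ((min_le_left _ _).trans (le_of_lt ht)),
        max_eq_left ((min_le_left _ _).trans hlt.le)]
    rcases lt_or_ge (τ (ν + 1)) t₀ with hlt' | hge'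
    · filter_upwards [mem_nhdsWithin_of_mem_nhds (Ioi_mem_nhds hlt')] with t ht
      rw [min_eq_right (le_of_lt ht), min_eq_right hlt'.le]
    have hfix : max (τ ν) (min t₀ (τ (ν + 1))) = t₀ := by rw [min_eq_left hge', max_eq_right hge]
    have hcont : Continuous fun t => max (τ ν) (min t (τ (ν + 1))) := by fun_prop
    have hmaps : Set.MapsTo (fun t => max (τ ν) (min t (τ (ν + 1)))) (Set.Icc a b)
        (Set.Icc a b) := by
      intro t ht
      have ha' : a ≤ τ ν := ha ▸ le_apply_of_forall_le_succ hτ ν.zero_le hν.le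
      have hb' : τ (ν + 1) ≤ b := hb ▸ le_apply_of_forall_le_succ hτ hν le_rfl
      exact ⟨ha'.trans (le_max_left _ _), max_le (h₁.trans hb') ((min_le_right _ _).trans hb')⟩
    have htend := hcont.continuousWithinAt.tendsto_nhdsWithin hmaps (x := t₀)
    rw [hfix] at htend ⊢
    exact htend.eventually (hs ν hν ⟨hge, hge'⟩)
  filter_upwards [(Filter.eventually_all_finset _).2 hev, self_mem_nhdsWithin] with t ht htI
  rw [key t htI, key t₀ ht₀]
  congr 1
  exact Finset.sum_congr rfl ht

theorem clampSum_left_sub_right (hτ : ∀ ν < k, τ ν ≤ τ (ν + 1)) (ha : τ 0 = a) (hb : τ k = b) :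
    clampSum τ k s a - clampSum τ k s b =
      ∑ ν ∈ Finset.range k, (s ν (τ ν) - s ν (τ (ν + 1))) := by
  rw [clampSum, clampSum, ← Finset.sum_sub_distrib]
  refine Finset.sum_congr rfl fun ν hν => ?_
  rw [Finset.mem_range] at hν
  have ha' : a ≤ τ ν := ha ▸ le_apply_of_forall_le_succ hτ ν.zero_le hν.le
  have hb' : τ (ν + 1) ≤ b := hb ▸ le_apply_of_forall_le_succ hτ hν le_rfl
  rw [max_eq_left ((min_le_left _ _).trans ha'), min_eq_right hb', max_eq_right (hτ ν hν)]

/-- If the variation of the functions `s ν` and `s' ν` is locally given by a common function,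
independent of `ν`, then the total variation along both partitions is the same. -/
theorem sum_sub_eq_sum_sub (hab : a ≤ b) (hτ : ∀ ν < k, τ ν ≤ τ (ν + 1)) (ha : τ 0 = a)
    (hb : τ k = b) (hτ' : ∀ ν < k', τ' ν ≤ τ' (ν + 1)) (ha' : τ' 0 = a) (hb' : τ' k' = b)
    (hs : ∀ t₀ ∈ Set.Icc a b, ∃ g : ℝ → ℤ,
      (∀ ν < k, t₀ ∈ Set.Icc (τ ν) (τ (ν + 1)) →
        ∀ᶠ t in nhdsWithin t₀ (Set.Icc a b), s ν t - g t = s ν t₀ - g t₀) ∧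
      ∀ ν < k', t₀ ∈ Set.Icc (τ' ν) (τ' (ν + 1)) →
        ∀ᶠ t in nhdsWithin t₀ (Set.Icc a b), s' ν t - g t = s' ν t₀ - g t₀) :
    ∑ ν ∈ Finset.range k, (s ν (τ ν) - s ν (τ (ν + 1))) =
      ∑ ν ∈ Finset.range k', (s' ν (τ' ν) - s' ν (τ' (ν + 1))) := by
  have hloc : IsLocallyConstant
      fun t : Set.Icc a b => clampSum τ k s t - clampSum τ' k' s' t := by
    rw [IsLocallyConstant.iff_eventually_eq]
    rintro ⟨t₀, ht₀⟩
    obtain ⟨g, hg, hg'⟩ := hs t₀ ht₀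
    rw [eventually_nhds_subtype_iff (Set.Icc a b) ⟨t₀, ht₀⟩
      (fun t => clampSum τ k s t - clampSum τ' k' s' t =
        clampSum τ k s t₀ - clampSum τ' k' s' t₀)]
    filter_upwards [eventually_clampSum_sub_eq hτ ha hb ht₀ hg,
      eventually_clampSum_sub_eq hτ' ha' hb' ht₀ hg'] with t h h'
    linarith
  have : PreconnectedSpace (Set.Icc a b) :=
    isPreconnected_iff_preconnectedSpace.1 isPreconnected_Icc
  have heq := hloc.apply_eq_of_preconnectedSpace ⟨a, Set.left_mem_Icc.2 hab⟩
    ⟨b, Set.right_mem_Icc.2 hab⟩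
  rw [← clampSum_left_sub_right hτ ha hb, ← clampSum_left_sub_right hτ' ha' hb']
  dsimp only at heq
  linarith

end clampSum

/-- The signature sums along two partitions coincide for continuous families of Lagrangian
subspaces transverse to `L₁` and `L₂` on the respective intervals. -/
theorem IsLagrangianPath.sum_tripleSig_eq [FiniteDimensional ℝ E] {ω : BilinForm ℝ E}
    (halt : LinearMap.IsAlt ω) (hnd : LinearMap.BilinForm.Nondegenerate ω) {a b : ℝ} (hab : a ≤ b)
    {L₁ L₂ : ℝ → Submodule ℝ E} (h₁ : IsLagrangianPath ω a b L₁) (h₂ : IsLagrangianPath ω a b L₂)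
    {τ τ' : ℕ → ℝ} {k k' : ℕ} {M M' : ℕ → ℝ → Submodule ℝ E}
    (hτ : ∀ ν < k, τ ν ≤ τ (ν + 1)) (ha : τ 0 = a) (hb : τ k = b)
    (hM : ∀ ν < k, IsLagrangianPath ω a b (M ν))
    (hM₁ : ∀ ν < k, ∀ t ∈ Set.Icc (τ ν) (τ (ν + 1)), Disjoint (M ν t) (L₁ t))
    (hM₂ : ∀ ν < k, ∀ t ∈ Set.Icc (τ ν) (τ (ν + 1)), Disjoint (M ν t) (L₂ t))
    (hτ' : ∀ ν < k', τ' ν ≤ τ' (ν + 1)) (ha' : τ' 0 = a) (hb' : τ' k' = b)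
    (hM' : ∀ ν < k', IsLagrangianPath ω a b (M' ν))
    (hM₁' : ∀ ν < k', ∀ t ∈ Set.Icc (τ' ν) (τ' (ν + 1)), Disjoint (M' ν t) (L₁ t))
    (hM₂' : ∀ ν < k', ∀ t ∈ Set.Icc (τ' ν) (τ' (ν + 1)), Disjoint (M' ν t) (L₂ t)) :
    ∑ ν ∈ Finset.range k, (tripleSig ω (L₁ (τ ν)) (L₂ (τ ν)) (M ν (τ ν)) -
        tripleSig ω (L₁ (τ (ν + 1))) (L₂ (τ (ν + 1))) (M ν (τ (ν + 1)))) =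
      ∑ ν ∈ Finset.range k', (tripleSig ω (L₁ (τ' ν)) (L₂ (τ' ν)) (M' ν (τ' ν)) -
        tripleSig ω (L₁ (τ' (ν + 1))) (L₂ (τ' (ν + 1))) (M' ν (τ' (ν + 1)))) := by
  refine sum_sub_eq_sum_sub (s := fun ν t => tripleSig ω (L₁ t) (L₂ t) (M ν t))
    (s' := fun ν t => tripleSig ω (L₁ t) (L₂ t) (M' ν t)) hab hτ ha hb hτ' ha' hb'
    fun t₀ ht₀ => ?_
  let F : Bool ⊕ Fin k ⊕ Fin k' → Submodule ℝ E :=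
    Sum.elim (fun i => cond i (L₁ t₀) (L₂ t₀)) (Sum.elim (fun ν => M ν t₀) fun ν => M' ν t₀)
  have hF : ∀ i, IsLagrangian ω (F i) := by
    rintro ((_ | _) | ν | ν)
    · exact h₂.lag t₀ ht₀
    · exact h₁.lag t₀ ht₀
    · exact (hM ν ν.2).lag t₀ ht₀
    · exact (hM' ν ν.2).lag t₀ ht₀
  obtain ⟨K, hK, hKF⟩ := IsLagrangian.exists_forall_disjoint halt hnd hF
  obtain ⟨g, hg⟩ := h₁.exists_eventually_tripleSig_sub_eq halt hnd h₂ ht₀ hK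
    (hKF (.inl true)) (hKF (.inl false))
  exact ⟨g, fun ν hν ht => hg _ (hM ν hν) (hKF (.inr (.inl ⟨ν, hν⟩))) (hM₁ ν hν _ ht)
    (hM₂ ν hν _ ht), fun ν hν ht => hg _ (hM' ν hν) (hKF (.inr (.inr ⟨ν, hν⟩)))
    (hM₁' ν hν _ ht) (hM₂' ν hν _ ht)⟩

/-- symplectic invariance of the intersection number: for a continuous path
`A : [a,b] → Sp(E)`, the images `t ↦ A(t)L_i(t)` are continuous paths of Lagrangian subspaces
and `[A(t)L1(t) : A(t)L2(t)] = [L1 : L2]`, both intersection numbers being computed from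
arbitrary admissible data. -/
theorem intersection_number_symplectic_invariant [FiniteDimensional ℝ E]
    (ω : BilinForm ℝ E) (halt : LinearMap.IsAlt ω)
    (hnd : LinearMap.BilinForm.Nondegenerate ω)
    (a b : ℝ) (hab : a ≤ b)
    (L1 L2 : ℝ → Submodule ℝ E)
    (h1 : IsLagrangianPath ω a b L1) (h2 : IsLagrangianPath ω a b L2)
    (A : ℝ → E →L[ℝ] E) (hA : IsSymplecticPath ω a b A) :
    IsLagrangianPath ω a b (fun t => (L1 t).map (A t : E →ₗ[ℝ] E)) ∧
    IsLagrangianPath ω a b (fun t => (L2 t).map (A t : E →ₗ[ℝ] E)) ∧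
    ∀ D' : AdmissibleData ω a b (fun t => (L1 t).map (A t : E →ₗ[ℝ] E))
        (fun t => (L2 t).map (A t : E →ₗ[ℝ] E)),
      ∀ D : AdmissibleData ω a b L1 L2,
        dataSum D' = dataSum D := by
  refine ⟨h1.map hA, h2.map hA, fun D' D => ?_⟩
  have htD : ∀ ν < D.k, Set.Icc (D.t ν) (D.t (ν + 1)) ⊆ Set.Icc a b := fun ν hν =>
    Set.Icc_subset_Icc (D.ht0.ge.trans (le_apply_of_forall_le_succ D.hmono ν.zero_le hν.le))
      ((le_apply_of_forall_le_succ D.hmono hν le_rfl).trans D.htk.le)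
  have hsig : ∀ M, ∀ t ∈ Set.Icc a b, tripleSig ω ((L1 t).map (A t : E →ₗ[ℝ] E))
      ((L2 t).map (A t : E →ₗ[ℝ] E)) (M.map (A t : E →ₗ[ℝ] E)) = tripleSig ω (L1 t) (L2 t) M :=
    fun M t ht => tripleSig_map (hA.bij t ht).1 (hA.symp t ht) _ _ _
  have hsum := (h1.map hA).sum_tripleSig_eq halt hnd hab (h2.map hA)
    (M := fun ν _ => D'.M (ν + 1)) (M' := fun ν t => (D.M (ν + 1)).map (A t : E →ₗ[ℝ] E))
    D'.hmono D'.ht0 D'.htk (fun ν hν => .const (D'.hlag ν hν))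
    (fun ν hν t ht => disjoint_iff.2 (D'.htrans1 ν hν t ht))
    (fun ν hν t ht => disjoint_iff.2 (D'.htrans2 ν hν t ht))
    D.hmono D.ht0 D.htk (fun ν hν => (IsLagrangianPath.const (D.hlag ν hν)).map hA)
    (fun ν hν t ht => Submodule.disjoint_map (hA.bij t (htD ν hν ht)).1
      (disjoint_iff.2 (D.htrans1 ν hν t ht)))
    (fun ν hν t ht => Submodule.disjoint_map (hA.bij t (htD ν hν ht)).1
      (disjoint_iff.2 (D.htrans2 ν hν t ht)))
  have hD : ∀ ν ∈ Finset.range D.k, _ := fun ν hν =>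
    have hν' := Finset.mem_range.1 hν
    congrArg₂ (· - ·)
      (hsig (D.M (ν + 1)) _ (htD ν hν' (Set.left_mem_Icc.2 (D.hmono ν hν'))))
      (hsig (D.M (ν + 1)) _ (htD ν hν' (Set.right_mem_Icc.2 (D.hmono ν hν'))))
  rw [Finset.sum_congr rfl hD] at hsum
  rw [dataSum, dataSum]
  exact_mod_cast congrArg (fun n : ℤ => (1 / 2 : ℝ) * n) hsum
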